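/- Exact traveling-wave solution of the Fisher–KPP equation: the function ρ(x,t) := 1/(1 + exp(−(5/6)t + x/√6))² is smooth on ℝ² and satisfies ∂_t ρ = ∂²_{xx} ρ + ρ(1−ρ) everywhere on ℝ², and 0 < ρ(x,t) < 1 for all (x,t). -/

import Mathlib

/-- Exact traveling-wave solution of the Fisher–KPP equation:
`ρ(x,t) = 1/(1 + exp(-(5/6)t + x/√6))²` is smooth on `ℝ²`, satisfies
`∂_t ρ = ∂²_{xx} ρ + ρ(1-ρ)` everywhere, and `0 < ρ < 1`. -/
theorem stmt18 (ρ : ℝ → ℝ → ℝ)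
    (hρ : ∀ x t, ρ x t =
      1 / (1 + Real.exp (-(5 / 6) * t + x / Real.sqrt 6)) ^ 2) :
    ContDiff ℝ (⊤ : ℕ∞) (fun p : ℝ × ℝ => ρ p.1 p.2) ∧
    (∀ x t, deriv (fun s => ρ x s) t =
      deriv (deriv (fun y => ρ y t)) x + ρ x t * (1 - ρ x t)) ∧
    (∀ x t, 0 < ρ x t ∧ ρ x t < 1) := by
  have hfun : ρ = fun x t => 1 / (1 + Real.exp (-(5 / 6) * t + x / Real.sqrt 6)) ^ 2 := by
    funext x t; exact hρ x t
  subst hfun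
  have hpos : ∀ z : ℝ, 0 < 1 + Real.exp z := fun z => by positivity
  refine ⟨?_, ?_, ?_⟩
  · refine ContDiff.div contDiff_const ?_ (fun p => (pow_pos (hpos _) 2).ne')
    fun_prop
  · intro x t
    have hk : (1 / Real.sqrt 6) ^ 2 = 1 / 6 := by
      rw [div_pow, Real.sq_sqrt (by norm_num)]; norm_num
    generalize hkk : 1 / Real.sqrt 6 = k at hk
    have hdiv : ∀ y : ℝ, y / Real.sqrt 6 = y * k := fun y => by rw [← hkk]; ring
    simp only [hdiv]
    have hEx : ∀ y, HasDerivAt (fun y => Real.exp (-(5 / 6) * t + y * k))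
        (Real.exp (-(5 / 6) * t + y * k) * k) y := fun y => by
      have h := (((hasDerivAt_id y).mul_const k).const_add (-(5 / 6) * t)).exp
      simpa using h
    have hEt : HasDerivAt (fun s => Real.exp (-(5 / 6) * s + x * k))
        (Real.exp (-(5 / 6) * t + x * k) * (-(5 / 6))) t := by
      have h := (((hasDerivAt_id t).const_mul (-(5 / 6) : ℝ)).add_const (x * k)).exp
      simpa using h
    have h1 : HasDerivAt (fun s => 1 / (1 + Real.exp (-(5 / 6) * s + x * k)) ^ 2)
        ((5 / 3) * Real.exp (-(5 / 6) * t + x * k) /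
          (1 + Real.exp (-(5 / 6) * t + x * k)) ^ 3) t := by
      have hne := (hpos (-(5 / 6) * t + x * k)).ne'
      have h := (hasDerivAt_const t (1 : ℝ)).fun_div ((hEt.const_add 1).fun_pow 2) (pow_ne_zero 2 hne)
      refine h.congr_deriv ?_
      field_simp
      ring
    have h2 : ∀ y, HasDerivAt (fun y => 1 / (1 + Real.exp (-(5 / 6) * t + y * k)) ^ 2)
        (-2 * k * Real.exp (-(5 / 6) * t + y * k) /
          (1 + Real.exp (-(5 / 6) * t + y * k)) ^ 3) y := fun y => by
      have hne := (hpos (-(5 / 6) * t + y * k)).ne'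
      have h := (hasDerivAt_const y (1 : ℝ)).fun_div (((hEx y).const_add 1).fun_pow 2) (pow_ne_zero 2 hne)
      refine h.congr_deriv ?_
      field_simp
      ring
    have hd : deriv (fun y => 1 / (1 + Real.exp (-(5 / 6) * t + y * k)) ^ 2) =
        fun y => -2 * k * Real.exp (-(5 / 6) * t + y * k) /
          (1 + Real.exp (-(5 / 6) * t + y * k)) ^ 3 := funext fun y => (h2 y).deriv
    have hne := (hpos (-(5 / 6) * t + x * k)).ne'
    have h3 := ((hEx x).const_mul (-2 * k)).fun_div (((hEx x).const_add 1).fun_pow 3)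
      (pow_ne_zero 3 hne)
    rw [h1.deriv, hd, h3.deriv]
    generalize Real.exp (-(5 / 6) * t + x * k) = E at hne
    have e : (-2 * k * (E * k) * (1 + E) ^ 3 - -2 * k * E * ((3 : ℕ) * (1 + E) ^ (3 - 1) * (E * k)))
        = (1 / 6) * (-2 * E * (1 + E) ^ 3 + 6 * E ^ 2 * (1 + E) ^ 2) := by
      rw [← hk]; push_cast; ring
    rw [e]
    field_simp
    ring
  · intro x t
    have h := Real.exp_pos (-(5 / 6) * t + x / Real.sqrt 6)
    refine ⟨by positivity, ?_⟩
    show 1 / (1 + Real.exp (-(5 / 6) * t + x / Real.sqrt 6)) ^ 2 < 1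
    rw [div_lt_one (by positivity)]
    nlinarith
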